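/- arXiv:2412.14410 — 3 statements merged into one kernel-verified Lean document; each statement's English description precedes it below -/
import Mathlib

section
/- Let n and m be positive integers with m ∣ n, m ≥ 2, and n odd. Let G be the subgroup of the permutation group of ZMod n generated by the translation t : x ↦ x + (n/m) (where n/m is cast into ZMod n) and the negation ν : x ↦ −x. Then the number of orbits of the action of G on ZMod n equals (n + m)/(2m). -/
theorem Equiv.addRight_zpow_apply {A : Type*} [AddGroup A] (a b : A) (k : ℤ) :
    (Equiv.addRight a ^ k : Equiv.Perm A) b = b + k • a := by
  induction k generalizing b with
  | zero => simp
  | succ k ih => rw [zpow_add_one, Equiv.Perm.mul_apply, ih, Equiv.coe_addRight, add_assoc,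
      add_comm (k : ℤ), one_add_zsmul]
  | pred k ih => rw [zpow_sub_one, Equiv.Perm.mul_apply, ih, Equiv.Perm.coe_inv,
      Equiv.addRight_symm_apply, add_assoc, sub_eq_neg_add, add_zsmul, neg_one_zsmul]

/-- Two residues modulo `n` lie in the same orbit of the group generated by `x ↦ x + d` and
`x ↦ -x`, where `d ∣ n`, iff they agree up to sign modulo `d`. -/
theorem orbitRel_closure_addRight_neg_iff {n d : ℕ} (hd : d ∣ n) (x y : ZMod n) :
    MulAction.orbitRel
        (Subgroup.closure {Equiv.addRight (d : ZMod n), Equiv.neg (ZMod n)} :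
          Subgroup (Equiv.Perm (ZMod n))) (ZMod n) x y ↔
      (ZMod.castHom hd (ZMod d) x).valMinAbs.natAbs =
        (ZMod.castHom hd (ZMod d) y).valMinAbs.natAbs := by
  set G : Subgroup (Equiv.Perm (ZMod n)) :=
    Subgroup.closure {Equiv.addRight (d : ZMod n), Equiv.neg (ZMod n)}
  have ht : Equiv.addRight (d : ZMod n) ∈ G := Subgroup.subset_closure (by simp)
  have hν : Equiv.neg (ZMod n) ∈ G := Subgroup.subset_closure (by simp)
  rw [MulAction.orbitRel_apply]
  constructor
  · rintro ⟨⟨g, hg⟩, rfl⟩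
    change (ZMod.castHom hd (ZMod d) (g y)).valMinAbs.natAbs = _
    induction hg using Subgroup.closure_induction generalizing y with
    | mem g hg =>
      rcases hg with rfl | rfl
      · simp only [Equiv.coe_addRight, map_add, map_natCast, ZMod.natCast_self, add_zero]
      · simp only [Equiv.neg_apply, map_neg, ZMod.natAbs_valMinAbs_neg]
    | one => rfl
    | mul g h _ _ ihg ihh => rw [Equiv.Perm.mul_apply, ihg, ihh]
    | inv g _ ih => rw [← ih (g⁻¹ y), Equiv.Perm.coe_inv, Equiv.apply_symm_apply]
  · have translate (x y : ZMod n) (h : ZMod.castHom hd (ZMod d) x = ZMod.castHom hd (ZMod d) y) :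
        x ∈ MulAction.orbit G y := by
      obtain ⟨a, rfl⟩ := ZMod.intCast_surjective x
      obtain ⟨b, rfl⟩ := ZMod.intCast_surjective y
      rw [map_intCast, map_intCast, eq_comm, ZMod.intCast_eq_intCast_iff_dvd_sub] at h
      obtain ⟨k, hk⟩ := h
      refine ⟨⟨Equiv.addRight (d : ZMod n) ^ k, G.zpow_mem ht k⟩, ?_⟩
      change (Equiv.addRight (d : ZMod n) ^ k) (b : ZMod n) = a
      rw [Equiv.addRight_zpow_apply, zsmul_eq_mul, ← sub_add_cancel a b, hk]
      push_cast
      ring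
    rw [ZMod.natAbs_valMinAbs_eq_natAbs_valMinAbs, ← map_neg]
    rintro (h | h)
    · exact translate x y h
    · rw [← MulAction.orbit_eq_iff.mpr ⟨(⟨_, hν⟩ : G), rfl⟩]
      exact translate x (-y) h

/-- The group generated by `x ↦ x + d` and `x ↦ -x`, where `d ∣ n`, has `d / 2 + 1` orbits
on `ZMod n`. -/
theorem card_orbits_closure_addRight_neg {n d : ℕ} [NeZero d] (hd : d ∣ n) :
    Nat.card (MulAction.orbitRel.Quotient
      (Subgroup.closure {Equiv.addRight (d : ZMod n), Equiv.neg (ZMod n)} :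
        Subgroup (Equiv.Perm (ZMod n))) (ZMod n)) = d / 2 + 1 := by
  let f (x : ZMod n) : Fin (d / 2 + 1) :=
    ⟨(ZMod.castHom hd (ZMod d) x).valMinAbs.natAbs, Nat.lt_succ_of_le (ZMod.natAbs_valMinAbs_le _)⟩
  have hf : Function.Surjective f := fun i => ⟨(i : ℕ), Fin.ext <| by
    simp [f, ZMod.valMinAbs_natCast_of_le_half (Nat.le_of_lt_succ i.isLt), -ZMod.castHom_apply]⟩
  have hker : MulAction.orbitRel
      (Subgroup.closure {Equiv.addRight (d : ZMod n), Equiv.neg (ZMod n)} :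
        Subgroup (Equiv.Perm (ZMod n))) (ZMod n) = Setoid.ker f :=
    Setoid.ext fun x y =>
      (orbitRel_closure_addRight_neg_iff hd x y).trans (by simp [Setoid.ker_def, f])
  rw [MulAction.orbitRel.Quotient, hker,
    Nat.card_congr (Setoid.quotientKerEquivOfSurjective f hf), Nat.card_fin]


/-- For `m ∣ n`, `m ≥ 2`, `n` odd, the subgroup of `Perm (ZMod n)` generated by
`x ↦ x + n/m` and `x ↦ -x` has `(n + m)/(2m)` orbits on `ZMod n`. -/
theorem card_orbits_dihedral_n_odd (n m : ℕ) (hn : 0 < n) (hm : 2 ≤ m)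
    (hdvd : m ∣ n) (hodd : Odd n) :
    Nat.card (MulAction.orbitRel.Quotient
      (Subgroup.closure
        {Equiv.addRight ((n / m : ℕ) : ZMod n), Equiv.neg (ZMod n)} :
        Subgroup (Equiv.Perm (ZMod n)))
      (ZMod n)) = (n + m) / (2 * m) := by
  obtain ⟨d, rfl⟩ := hdvd
  have hm0 : 0 < m := by lia
  have hd : Odd d := (Nat.odd_mul.mp hodd).2
  have : NeZero d := ⟨hd.pos.ne'⟩
  rw [Nat.mul_div_cancel_left d hm0, card_orbits_closure_addRight_neg (Dvd.intro_left m rfl)]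
  obtain ⟨k, rfl⟩ := hd
  rw [show m * (2 * k + 1) + m = 2 * m * (k + 1) by ring, Nat.mul_div_cancel_left _ (by lia)]
  lia
end

section
/- Let n and m be positive integers with 2m ∣ n and m ≥ 2. Let G be the subgroup of the permutation group of ZMod n generated by the translation t : x ↦ x + (n/m) (where n/m is cast into ZMod n) and the negation ν : x ↦ −x. Then the number of orbits of the action of G on ZMod n equals (n + 2m)/(2m). -/
open MulAction in
/-- A function to `β` which is surjective and whose fibres are exactly the orbits of a group action
computes the number of orbits. -/
theorem card_orbitRel_quotient_of_surjective {G α β : Type*} [Group G] [MulAction G α]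
    (f : α → β) (hf : Function.Surjective f) (h : ∀ x y, f x = f y ↔ x ∈ orbit G y) :
    Nat.card (orbitRel.Quotient G α) = Nat.card β := by
  refine Nat.card_eq_of_bijective
    (Quotient.lift f fun x y hxy => (h x y).2 (orbitRel_apply.1 hxy)) ⟨?_, fun b => ?_⟩
  · rintro ⟨x⟩ ⟨y⟩ hxy
    exact Quotient.sound (orbitRel_apply.2 ((h x y).1 hxy))
  · obtain ⟨x, rfl⟩ := hf b
    exact ⟨Quotient.mk _ x, rfl⟩

/-- A function invariant under a set of permutations is invariant under the subgroup that the set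
generates. -/
theorem Subgroup.apply_eq_of_mem_closure {α β : Type*} {s : Set (Equiv.Perm α)} {f : α → β}
    (hs : ∀ g ∈ s, ∀ x, f (g x) = f x) {g : Equiv.Perm α} (hg : g ∈ Subgroup.closure s) (x : α) :
    f (g x) = f x := by
  induction hg using Subgroup.closure_induction generalizing x with
  | mem g hg => exact hs g hg x
  | one => rfl
  | mul g h _ _ ihg ihh => rw [Equiv.Perm.mul_apply, ihg, ihh]
  | inv g _ ih => rw [← ih, ← Equiv.Perm.mul_apply, mul_inv_cancel, Equiv.Perm.one_apply]

theorem ZMod.natAbs_valMinAbs_eq_iff {n : ℕ} {a b : ZMod n} :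
    a.valMinAbs.natAbs = b.valMinAbs.natAbs ↔ a = b ∨ a = -b := by
  refine ⟨fun h => ?_, ?_⟩
  · rw [← a.coe_valMinAbs, ← b.coe_valMinAbs]
    rcases Int.natAbs_eq_natAbs_iff.1 h with h | h
    · exact Or.inl (by rw [h])
    · exact Or.inr (by rw [h, Int.cast_neg])
  · rintro (rfl | rfl)
    · rfl
    · exact ZMod.natAbs_valMinAbs_neg b

/-- Elements of `ZMod n` that agree modulo a divisor `d` of `n` differ by a multiple of `d`. -/
theorem ZMod.exists_eq_add_zsmul_of_castHom_eq {d n : ℕ} (h : d ∣ n) {x y : ZMod n}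
    (hxy : ZMod.castHom h (ZMod d) x = ZMod.castHom h (ZMod d) y) :
    ∃ c : ℤ, x = y + c • (d : ZMod n) := by
  obtain ⟨a, rfl⟩ := ZMod.intCast_surjective x
  obtain ⟨b, rfl⟩ := ZMod.intCast_surjective y
  rw [map_intCast, map_intCast, ZMod.intCast_eq_intCast_iff_dvd_sub] at hxy
  obtain ⟨c, hc⟩ := hxy
  refine ⟨-c, ?_⟩
  have : a = b + -c * d := by linarith
  rw [this]
  simp

/-- For `2m ∣ n`, `m ≥ 2`, the subgroup of `Perm (ZMod n)` generated by
`x ↦ x + n/m` and `x ↦ -x` has `(n + 2m)/(2m)` orbits on `ZMod n`. -/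
theorem card_orbits_dihedral_two_m_dvd (n m : ℕ) (hn : 0 < n) (hm : 2 ≤ m)
    (hdvd : 2 * m ∣ n) :
    Nat.card (MulAction.orbitRel.Quotient
      (Subgroup.closure
        {Equiv.addRight ((n / m : ℕ) : ZMod n), Equiv.neg (ZMod n)} :
        Subgroup (Equiv.Perm (ZMod n)))
      (ZMod n)) = (n + 2 * m) / (2 * m) := by
  obtain ⟨k, hk⟩ := hdvd
  have hk0 : 0 < k := Nat.pos_of_ne_zero (by rintro rfl; omega)
  have hd : n / m = 2 * k := by
    rw [hk, mul_right_comm, Nat.mul_div_cancel _ (by omega)]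
  have hcard : (n + 2 * m) / (2 * m) = k + 1 := by
    rw [Nat.add_div_right _ (by omega), hk, Nat.mul_div_cancel_left _ (by omega)]
  have hdn : 2 * k ∣ n := ⟨m, by rw [hk]; ring⟩
  have : NeZero (2 * k) := ⟨by omega⟩
  rw [hd, hcard]
  set s : Set (Equiv.Perm (ZMod n)) :=
    {Equiv.addRight ((2 * k : ℕ) : ZMod n), Equiv.neg (ZMod n)}
  let π := ZMod.castHom hdn (ZMod (2 * k))
  let f : ZMod n → Fin (k + 1) := fun x => ⟨(π x).valMinAbs.natAbs, by
    have := ZMod.natAbs_valMinAbs_le (π x)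
    omega⟩
  have hf {x y : ZMod n} : f x = f y ↔ π x = π y ∨ π x = -π y := by
    rw [← ZMod.natAbs_valMinAbs_eq_iff, Fin.ext_iff]
  have ht : Equiv.addRight ((2 * k : ℕ) : ZMod n) ∈ Subgroup.closure s :=
    Subgroup.subset_closure (Or.inl rfl)
  have hν : Equiv.neg (ZMod n) ∈ Subgroup.closure s := Subgroup.subset_closure (Or.inr rfl)
  have horbit {x y : ZMod n} (h : π x = π y) : x ∈ MulAction.orbit (Subgroup.closure s) y := by
    obtain ⟨c, rfl⟩ := ZMod.exists_eq_add_zsmul_of_castHom_eq hdn h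
    refine ⟨⟨_, zpow_mem ht c⟩, ?_⟩
    simp [Subgroup.smul_def]
  rw [card_orbitRel_quotient_of_surjective f, Nat.card_fin]
  · intro j
    refine ⟨((j : ℕ) : ZMod n), Fin.ext ?_⟩
    change (π ((j : ℕ) : ZMod n)).valMinAbs.natAbs = j
    rw [map_natCast, ZMod.valMinAbs_natCast_of_le_half (by omega), Int.natAbs_natCast]
  · refine fun x y => ⟨fun h => ?_, ?_⟩
    · rcases hf.1 h with h | h
      · exact horbit h
      · rw [← map_neg] at h
        rw [← MulAction.orbit_eq_iff.2
          (⟨⟨_, hν⟩, rfl⟩ : -y ∈ MulAction.orbit (Subgroup.closure s) y)]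
        exact horbit h
    · rintro ⟨g, rfl⟩
      refine Subgroup.apply_eq_of_mem_closure ?_ g.2 y
      rintro _ (rfl | rfl) x
      · refine hf.2 (Or.inl ?_)
        rw [Equiv.coe_addRight, map_add, map_natCast, ZMod.natCast_self, add_zero]
      · exact hf.2 (Or.inr (map_neg π x))
end

section
/- Let n and m be positive integers with 2m ∣ n and m ≥ 2. Let G be the subgroup of the permutation group of ZMod n generated by the translation t : x ↦ x + (n/m) (where n/m is cast into ZMod n) and the reflection ρ : x ↦ 1 − x. Then the number of orbits of the action of G on ZMod n equals n/(2m). -/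
/-- Modulo a common divisor `d` of `n` and of the translation length, every element of the group
generated by `x ↦ x + c` and `x ↦ 1 - x` acts as the identity or as `x ↦ 1 - x`. -/
theorem castHom_apply_of_mem_closure {n d : ℕ} (hd : d ∣ n) {c : ZMod n}
    (hc : ZMod.castHom hd (ZMod d) c = 0) {g : Equiv.Perm (ZMod n)}
    (hg : g ∈ Subgroup.closure {Equiv.addRight c, Equiv.subLeft (1 : ZMod n)}) :
    ∀ x, ZMod.castHom hd (ZMod d) (g x) = ZMod.castHom hd (ZMod d) x ∨
      ZMod.castHom hd (ZMod d) (g x) = 1 - ZMod.castHom hd (ZMod d) x := by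
  induction hg using Subgroup.closure_induction with
  | mem g hg =>
    intro x
    rcases hg with rfl | rfl
    · left
      rw [Equiv.coe_addRight, map_add, hc, add_zero]
    · right
      rw [Equiv.subLeft_apply, map_sub, map_one]
  | one => exact fun x => Or.inl rfl
  | mul g h _ _ ihg ihh =>
    intro x
    rw [Equiv.Perm.mul_apply]
    rcases ihg (h x) with h₁ | h₁ <;> rcases ihh x with h₂ | h₂ <;> rw [h₁, h₂] <;> simp
  | inv g _ ih =>
    intro x
    have h := ih (g⁻¹ x)
    rw [← Equiv.Perm.mul_apply, mul_inv_cancel, Equiv.Perm.one_apply] at h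
    rcases h with h | h <;> rw [h] <;> simp

/-- The residues `1, …, k` represent the orbits of the group generated by `x ↦ x + 2k` and
`x ↦ 1 - x` on `ZMod n`, where `2k ∣ n`. -/
theorem bijective_mk_orbits_translation_reflection {n k : ℕ} (hn : 0 < n) (hk : 2 * k ∣ n) :
    Function.Bijective (fun i : Fin k =>
      (Quotient.mk'' ((i + 1 : ℕ) : ZMod n) : MulAction.orbitRel.Quotient
        (Subgroup.closure {Equiv.addRight ((2 * k : ℕ) : ZMod n), Equiv.subLeft (1 : ZMod n)} :
          Subgroup (Equiv.Perm (ZMod n))) (ZMod n))) := by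
  have : NeZero n := ⟨hn.ne'⟩
  have hkpos : 0 < k := by
    rcases Nat.eq_zero_or_pos k with rfl | h
    · simp at hk; omega
    · exact h
  constructor
  · intro i j hij
    obtain ⟨⟨g, hg⟩, hgx⟩ := Quotient.eq''.mp hij
    have hgx : g ((j + 1 : ℕ) : ZMod n) = ((i + 1 : ℕ) : ZMod n) := hgx
    have hc : ZMod.castHom hk (ZMod (2 * k)) ((2 * k : ℕ) : ZMod n) = 0 := by
      rw [map_natCast, ZMod.natCast_self]
    have h := castHom_apply_of_mem_closure hk hc hg ((j + 1 : ℕ) : ZMod n)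
    rw [hgx, map_natCast, map_natCast] at h
    rcases h with h | h
    · rw [ZMod.natCast_eq_natCast_iff', Nat.mod_eq_of_lt (by omega),
        Nat.mod_eq_of_lt (by omega)] at h
      exact Fin.ext (by omega)
    · have h0 : ((i + 1 + j : ℕ) : ZMod (2 * k)) = 0 := by
        rw [Nat.cast_add, h]
        push_cast
        ring
      rw [ZMod.natCast_eq_zero_iff] at h0
      have := Nat.le_of_dvd (by omega) h0
      omega
  · intro q
    induction q using Quotient.inductionOn' with
    | h x =>
    set G : Subgroup (Equiv.Perm (ZMod n)) :=
      Subgroup.closure {Equiv.addRight ((2 * k : ℕ) : ZMod n), Equiv.subLeft (1 : ZMod n)}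
    have ht : Equiv.addRight ((2 * k : ℕ) : ZMod n) ∈ G := Subgroup.subset_closure (by simp)
    have hr : Equiv.subLeft (1 : ZMod n) ∈ G := Subgroup.subset_closure (by simp)
    have hx : ((2 * k * (x.val / (2 * k)) + x.val % (2 * k) : ℕ) : ZMod n) = x := by
      rw [Nat.div_add_mod, ZMod.natCast_zmod_val]
    have hlt : x.val % (2 * k) < 2 * k := Nat.mod_lt _ (by omega)
    generalize x.val / (2 * k) = a at hx
    generalize x.val % (2 * k) = r at hx hlt
    have key : ∀ i : Fin k, ∀ g ∈ G, g x = ((i + 1 : ℕ) : ZMod n) →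
        ∃ i : Fin k, (Quotient.mk'' ((i + 1 : ℕ) : ZMod n) :
          MulAction.orbitRel.Quotient G (ZMod n)) = Quotient.mk'' x :=
      fun i g hg h => ⟨i, Quotient.eq''.mpr ⟨⟨g, hg⟩, h⟩⟩
    have hta : (Equiv.addRight ((2 * k : ℕ) : ZMod n) ^ a)⁻¹ x = (r : ZMod n) := by
      rw [Equiv.Perm.inv_eq_iff_eq, ← Equiv.Perm.iterate_eq_pow, Equiv.coe_addRight,
        add_right_iterate, ← hx]
      push_cast
      simp only [nsmul_eq_mul]
      ring
    have htm := G.inv_mem (G.pow_mem ht a)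
    rcases Nat.eq_zero_or_pos r with rfl | hr0
    · refine key ⟨0, hkpos⟩ _ (G.mul_mem hr htm) ?_
      rw [Equiv.Perm.mul_apply, hta]
      simp
    · by_cases hrk : r ≤ k
      · refine key ⟨r - 1, by omega⟩ _ htm ?_
        rw [hta, Nat.sub_add_cancel hr0]
      · refine key ⟨2 * k - r, by omega⟩ _ (G.mul_mem ht (G.mul_mem hr htm)) ?_
        rw [Equiv.Perm.mul_apply, Equiv.Perm.mul_apply, hta, Equiv.subLeft_apply,
          Equiv.coe_addRight, Nat.cast_add, Nat.cast_sub hlt.le]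
        push_cast
        ring

/-- For `2m ∣ n`, `m ≥ 2`, the subgroup of `Perm (ZMod n)` generated by
`x ↦ x + n/m` and the reflection `x ↦ 1 - x` has `n/(2m)` orbits on `ZMod n`. -/
theorem card_orbits_dihedral_edge_reflections (n m : ℕ) (hn : 0 < n) (hm : 2 ≤ m)
    (hdvd : 2 * m ∣ n) :
    Nat.card (MulAction.orbitRel.Quotient
      (Subgroup.closure
        {Equiv.addRight ((n / m : ℕ) : ZMod n), Equiv.subLeft (1 : ZMod n)} :
        Subgroup (Equiv.Perm (ZMod n)))
      (ZMod n)) = n / (2 * m) := by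
  obtain ⟨k, hk⟩ := hdvd
  have hdiv : n / m = 2 * k := by
    rw [hk, mul_comm 2 m, mul_assoc, Nat.mul_div_cancel_left _ (by omega)]
  have hdiv' : n / (2 * m) = k := by
    rw [hk, Nat.mul_div_cancel_left _ (by omega)]
  have hkn : 2 * k ∣ n := ⟨m, by rw [hk]; ring⟩
  rw [hdiv, hdiv', ← Nat.card_eq_of_bijective _
    (bijective_mk_orbits_translation_reflection hn hkn), Nat.card_fin]
end
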